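/- Let B be a nonunital C*-algebra with real rank zero. Then V(B) is the direct limit of the monoids V(pBp) over the set of projections p ∈ B, directed by the relation V(pBp) ⊆ V(rBr): for any two projections p, q ∈ B there exists a projection r ∈ B with V(pBp) ∪ V(qBq) ⊆ V(rBr). -/

import Mathlib

/-- A projection in some matrix algebra `M_n(B)` over `B`. -/
structure MatProj (B : Type*) [NonUnitalRing B] [StarRing B] where
  n : ℕ
  p : Matrix (Fin n) (Fin n) B
  idem : p * p = p
  sa : p.conjTranspose = p

/-- Murray–von Neumann equivalence of projections in matrices over `B`. -/
def MvNEquiv {B : Type*} [NonUnitalRing B] [StarRing B] (P Q : MatProj B) : Prop :=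
  ∃ x : Matrix (Fin P.n) (Fin Q.n) B,
    x * x.conjTranspose = P.p ∧ x.conjTranspose * x = Q.p

/-- `B` has real rank zero: the invertible self-adjoint elements are dense in the
self-adjoint part of the minimal unitization. -/
def RealRankZero (B : Type*) [NonUnitalCStarAlgebra B] : Prop :=
  ∀ x : Unitization ℂ B, IsSelfAdjoint x →
    x ∈ closure {y : Unitization ℂ B | IsSelfAdjoint y ∧ IsUnit y}

/-- `x` lies in the corner `rBr` determined by the projection `r`. -/
def InCorner {B : Type*} [NonUnitalRing B] (r x : B) : Prop := r * x * r = x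

open CStarAlgebra in
/-- If a projection `p` is almost dominated by a projection `r`, then `p` is the range projection
of a partial isometry whose source projection lies under `r`. -/
lemma exists_mul_star_eq_of_norm_sub_mul_lt_one {A : Type*} [NonUnitalCStarAlgebra A] {p r : A}
    (hp : IsStarProjection p) (hr : IsStarProjection r) (h : ‖p - p * r‖ < 1) :
    ∃ x : A, x * star x = p ∧ x * r = x := by
  let _ := spectralOrder (Unitization ℂ A)
  have _ := spectralOrderedRing (Unitization ℂ A)
  set P : Unitization ℂ A := Unitization.inr p with hP
  set R : Unitization ℂ A := Unitization.inr r with hR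
  have hPP : P * P = P := by rw [hP, ← Unitization.inr_mul, hp.isIdempotentElem.eq]
  have hRR : R * R = R := by rw [hR, ← Unitization.inr_mul, hr.isIdempotentElem.eq]
  have hPs : star P = P := by rw [hP, ← Unitization.inr_star, hp.isSelfAdjoint.star_eq]
  have hRs : star R = R := by rw [hR, ← Unitization.inr_star, hr.isSelfAdjoint.star_eq]
  have hn : ‖P - P * R‖ < 1 := by
    rwa [hP, hR, ← Unitization.inr_mul, ← Unitization.inr_sub ℂ, Unitization.norm_inr]
  set b : Unitization ℂ A := P * R * P + (1 - P) with hb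
  have hb0 : 0 ≤ b := by
    have h1 : P * R * P = (P * R) * star (P * R) := by
      rw [star_mul, hPs, hRs, ← mul_assoc, mul_assoc P R R, hRR]
    have h2 : 1 - P = star (1 - P) * (1 - P) := by
      rw [star_sub, star_one, hPs, sub_mul, mul_sub, mul_sub, hPP]; simp
    rw [hb, h1, h2]
    exact add_nonneg (mul_star_self_nonneg _) (star_mul_self_nonneg _)
  have hbu : IsUnit b := by
    have h1 : 1 - b = (P - P * R) * star (P - P * R) := by
      rw [star_sub, star_mul, hPs, hRs, hb]
      have : P * R * (R * P) = P * R * P := by rw [← mul_assoc, mul_assoc P R R, hRR]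
      rw [sub_mul, mul_sub, mul_sub, this, ← mul_assoc, hPP]
      abel
    have h2 : ‖1 - b‖ < 1 := by
      rw [h1, CStarRing.norm_self_mul_star]
      exact mul_lt_one_of_nonneg_of_lt_one_left (norm_nonneg _) hn hn.le
    simpa using isUnit_one_sub_of_norm_lt_one h2
  set k : Unitization ℂ A := b ^ (-(1 / 2) : ℝ) with hk
  have hkbk : k * b * k = 1 :=
    CFC.conjugate_rpow_neg_one_half b (hbu.isStrictlyPositive hb0)
  have hks : star k = k := (IsSelfAdjoint.of_nonneg CFC.rpow_nonneg).star_eq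
  have hPb : P * b = P * R * P := by
    rw [hb, mul_add, mul_sub, hPP, ← mul_assoc, ← mul_assoc, hPP]; simp
  have hbP : b * P = P * R * P := by
    rw [hb, add_mul, sub_mul, mul_assoc _ P P, hPP]; simp
  have hkP : Commute k P := by
    rw [hk, CFC.rpow_def]
    exact Commute.cfc_nnreal (hbP.trans hPb.symm) _
  have hx : ((P * k * R).snd : Unitization ℂ A) = P * k * R := by
    ext <;> simp [hP]
  refine ⟨(P * k * R).snd, Unitization.inr_injective (R := ℂ) ?_,
    Unitization.inr_injective (R := ℂ) ?_⟩
  · rw [Unitization.inr_mul, Unitization.inr_star, hx, star_mul, star_mul, hPs, hRs, hks]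
    calc P * k * R * (R * (k * P)) = P * k * (R * R) * (k * P) := by simp only [mul_assoc]
      _ = k * (P * R * P) * k := by
        rw [hRR, ← hkP.eq, mul_assoc k P R, mul_assoc k (P * R), hkP.eq, mul_assoc k,
          ← mul_assoc (P * R)]
      _ = P * (k * b * k) := by
        rw [← hPb, ← mul_assoc, hkP.eq]; simp only [mul_assoc]
      _ = P := by rw [hkbk, mul_one]
  · rw [Unitization.inr_mul, hx, mul_assoc, ← hR, hRR]

open CStarAlgebra in
/-- In a C⋆-algebra of real rank zero, finitely many elements are almost fixed under right
multiplication by some projection. -/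
lemma RealRankZero.exists_isStarProjection {A : Type*} [NonUnitalCStarAlgebra A]
    (hA : RealRankZero A) {ι : Type*} [Fintype ι] (b : ι → A) {ε : ℝ} (hε : 0 < ε) :
    ∃ r : A, IsStarProjection r ∧ ∀ i, ‖b i - b i * r‖ < ε := by
  let _ := spectralOrder (Unitization ℂ A)
  have _ := spectralOrderedRing (Unitization ℂ A)
  obtain ⟨δ, hδ, hδε⟩ : ∃ δ : ℝ, 0 < δ ∧ δ + δ < ε ^ 2 := ⟨ε ^ 2 / 3, by positivity, by
    have : 0 < ε ^ 2 := by positivity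
    linarith⟩
  set a : Unitization ℂ A := ∑ i, star (b i : Unitization ℂ A) * (b i : Unitization ℂ A) with ha
  have ha0 : 0 ≤ a := Finset.sum_nonneg fun i _ ↦ star_mul_self_nonneg _
  have hafst : a.fst = 0 := by
    rw [ha, ← Unitization.fstHom_apply ℂ, map_sum]
    simp
  set x : Unitization ℂ A := a - algebraMap ℝ _ δ with hx
  have hxs : IsSelfAdjoint x := (IsSelfAdjoint.of_nonneg ha0).sub (.algebraMap _ (.all δ))
  obtain ⟨y, ⟨hys, hyu⟩, hxy⟩ := Metric.mem_closure_iff.1 (hA x hxs) δ hδ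
  rw [dist_eq_norm] at hxy
  let φ : Unitization ℂ A →⋆ₐ[ℂ] ℂ :=
    { Unitization.fstHom ℂ A with map_star' := fun _ ↦ rfl }
  have hφ : Continuous φ := map_continuous φ
  obtain ⟨l, hl⟩ : ∃ l : ℝ, φ y = algebraMap ℝ ℂ l :=
    ⟨(φ y).re, (Complex.conj_eq_iff_re.1 (map_star φ y ▸ congrArg φ hys.star_eq)).symm⟩
  have hxfst : x.fst = -(δ : ℂ) := by
    rw [hx, IsScalarTower.algebraMap_apply ℝ ℂ, ← Unitization.fstHom_apply ℂ, map_sub, AlgHom.commutes,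
      Unitization.fstHom_apply, hafst]
    simp
  have hl0 : l < 0 := by
    have h1 : ‖(x - y).fst‖ ≤ ‖x - y‖ := by
      rw [Unitization.norm_eq_sup]; exact le_sup_left
    have h2 : (x - y).fst = ((-δ - l : ℝ) : ℂ) := by
      change φ (x - y) = _
      rw [map_sub, show φ x = -(δ : ℂ) from hxfst, hl]
      simp
    rw [h2, Complex.norm_real, Real.norm_eq_abs] at h1
    linarith [(abs_lt.1 (h1.trans_lt hxy)).1]
  have h0 : (0 : ℝ) ∉ spectrum ℝ y := spectrum.zero_notMem ℝ hyu
  let f : ℝ → ℝ := fun t ↦ if 0 < t then 1 else 0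
  have hf : ContinuousOn f (spectrum ℝ y) := by
    intro t ht
    refine ContinuousAt.continuousWithinAt ?_
    rcases lt_or_gt_of_ne (ne_of_mem_of_not_mem ht h0) with h | h
    · exact continuousAt_const.congr
        (by filter_upwards [gt_mem_nhds h] with s hs using (if_neg hs.not_gt).symm)
    · exact continuousAt_const.congr
        (by filter_upwards [lt_mem_nhds h] with s hs using (if_pos hs).symm)
  set R : Unitization ℂ A := cfc f y with hR
  have hRs : star R = R := (cfc_predicate f y : IsSelfAdjoint _).star_eq
  have hRR : R * R = R := by
    rw [hR, ← cfc_mul f f y]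
    congr 1
    ext t
    simp [f]
  have hRfst : R.fst = 0 := by
    change φ R = 0
    rw [hR, StarAlgHomClass.map_cfc φ f y hf hφ hys (hys.map φ), hl, cfc_algebraMap]
    simp [f, hl0.not_gt]
  have hRsnd : Unitization.inr R.snd = R := by
    ext <;> simp [hRfst]
  have hE : 1 - R = cfc (fun t ↦ 1 - f t) y := by
    rw [cfc_sub (fun _ ↦ 1) f y, cfc_const_one ℝ y]
  have hEs : star (1 - R) = 1 - R := by rw [star_sub, star_one, hRs]
  have hEE : (1 - R) * (1 - R) = 1 - R := by
    rw [sub_mul, mul_sub, mul_sub, hRR]; simp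
  have hEyE : (1 - R) * y * (1 - R) ≤ 0 := by
    have : (1 - R) * y * (1 - R) = cfc (fun t ↦ (1 - f t) * t * (1 - f t)) y := by
      rw [cfc_mul (fun t ↦ (1 - f t) * t) (fun t ↦ 1 - f t) y,
        cfc_mul (fun t ↦ 1 - f t) (fun t ↦ t) y, cfc_id' ℝ y, hE]
    rw [this]
    refine cfc_nonpos _ _ fun t _ ↦ ?_
    by_cases ht : 0 < t
    · simp [f, ht]
    · simp only [f, if_neg ht]
      linarith
  have hay : a ≤ y + algebraMap ℝ _ (δ + δ) := by
    have h1 : x - y ≤ algebraMap ℝ _ δ :=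
      (hxs.sub hys).le_algebraMap_norm_self.trans (algebraMap_mono _ hxy.le)
    have h2 : a = y + ((x - y) + algebraMap ℝ _ δ) := by rw [hx]; abel
    rw [h2, map_add]
    gcongr
  have hEaE : (1 - R) * a * (1 - R) ≤ algebraMap ℝ _ (δ + δ) := by
    have h1 := star_left_conjugate_le_conjugate hay (1 - R)
    rw [hEs] at h1
    have hE1 : 1 - R ≤ 1 := by
      rw [sub_le_self_iff, ← hRR]
      nth_rw 1 [← hRs]
      exact star_mul_self_nonneg R
    calc _ ≤ _ := h1
      _ = (1 - R) * y * (1 - R) + (δ + δ) • (1 - R) := by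
        rw [mul_add, add_mul, ← Algebra.commutes, mul_assoc (algebraMap _ _ _), hEE,
          Algebra.smul_def]
      _ ≤ 0 + (δ + δ) • 1 := by gcongr
      _ = _ := by rw [zero_add, Algebra.algebraMap_eq_smul_one]
  refine ⟨R.snd, ⟨Unitization.inr_injective (R := ℂ) ?_, Unitization.inr_injective (R := ℂ) ?_⟩,
    fun i ↦ ?_⟩
  · rw [Unitization.inr_mul, hRsnd, hRR]
  · rw [Unitization.inr_star, hRsnd, hRs]
  set c : Unitization ℂ A := Unitization.inr (b i) with hc
  have hci : (Unitization.inr (b i - b i * R.snd) : Unitization ℂ A) = c * (1 - R) := by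
    rw [Unitization.inr_sub ℂ, Unitization.inr_mul, hRsnd, mul_sub, mul_one]
  have hca : star c * c ≤ a :=
    Finset.single_le_sum (f := fun i ↦ star (b i : Unitization ℂ A) * (b i : Unitization ℂ A))
      (fun i _ ↦ star_mul_self_nonneg _) (Finset.mem_univ i)
  have hcE : star (c * (1 - R)) * (c * (1 - R)) ≤ algebraMap ℝ _ (δ + δ) := by
    have h1 := star_left_conjugate_le_conjugate hca (1 - R)
    rw [hEs] at h1
    refine le_trans (le_of_eq ?_) (h1.trans hEaE)
    rw [star_mul, hEs]
    simp only [mul_assoc]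
  rw [← norm_le_iff_le_algebraMap _ (by positivity) (star_mul_self_nonneg _),
    CStarRing.norm_star_mul_self, ← hci, Unitization.norm_inr] at hcE
  exact lt_of_pow_lt_pow_left₀ 2 hε.le (by rw [sq]; exact hcE.trans_lt hδε)

/-- A matrix `x` with `x xᴴ = P` for a projection `P` makes `xᴴ x` a projection. -/
lemma MatProj.conjTranspose_mul_self_idem {B : Type*} [NonUnitalRing B] [StarRing B]
    (P : MatProj B) {m : ℕ} (x : Matrix (Fin P.n) (Fin m) B) (hx : x * x.conjTranspose = P.p)
    (hPx : P.p * x = x) :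
    x.conjTranspose * x * (x.conjTranspose * x) = x.conjTranspose * x := by
  rw [Matrix.mul_assoc, ← Matrix.mul_assoc x, hx, hPx]

/-- If every entry of `x` is fixed by right multiplication by the projection `r`, then
`xᴴ x` has entries in the corner of `r`. -/
lemma inCorner_conjTranspose_mul_self {B : Type*} [NonUnitalRing B] [StarRing B] {r : B}
    (hr : star r = r) {n m : ℕ} {x : Matrix (Fin n) (Fin m) B} (hx : ∀ i j, x i j * r = x i j)
    (i j : Fin m) : InCorner r ((x.conjTranspose * x) i j) := by
  have hx' (i j) : r * star (x i j) = star (x i j) := by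
    nth_rw 1 [← hr]
    rw [← star_mul, hx]
  simp only [InCorner, Matrix.mul_apply, Matrix.conjTranspose_apply, Finset.mul_sum,
    Finset.sum_mul]
  refine Finset.sum_congr rfl fun k _ ↦ ?_
  rw [← mul_assoc, hx', mul_assoc, hx]

/-- A projection `P = x xᴴ` is equivalent to `xᴴ x`, which lies in the corner of `r` when
the entries of `x` are fixed by right multiplication by `r`. -/
lemma MatProj.exists_mvNEquiv_inCorner {B : Type*} [NonUnitalRing B] [StarRing B]
    (P : MatProj B) {r : B} (hr : star r = r) {m : ℕ} (x : Matrix (Fin P.n) (Fin m) B)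
    (hx : x * x.conjTranspose = P.p) (hPx : P.p * x = x) (hxr : ∀ i j, x i j * r = x i j) :
    ∃ Q : MatProj B, (∀ i j, InCorner r (Q.p i j)) ∧ MvNEquiv P Q :=
  ⟨⟨m, x.conjTranspose * x, P.conjTranspose_mul_self_idem x hx hPx, by simp⟩,
    inCorner_conjTranspose_mul_self hr hxr, x, hx, rfl⟩

/-- If `p = x x⋆` and `x` is fixed by right multiplication by `r`, then every projection over the
corner of `p` is equivalent to one over the corner of `r`. -/
lemma MatProj.exists_mvNEquiv_of_inCorner {B : Type*} [NonUnitalRing B] [StarRing B]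
    (P : MatProj B) {p r x : B} (hp : p * p = p) (hr : star r = r) (hx : x * star x = p)
    (hxr : x * r = x) (hP : ∀ i j, InCorner p (P.p i j)) :
    ∃ Q : MatProj B, (∀ i j, InCorner r (Q.p i j)) ∧ MvNEquiv P Q := by
  have hPp (i j) : P.p i j * p = P.p i j := by
    rw [← hP i j, mul_assoc, hp]
  refine P.exists_mvNEquiv_inCorner hr (P.p * Matrix.diagonal fun _ ↦ x) ?_ ?_ fun i j ↦ ?_
  · have : P.p * Matrix.diagonal (fun _ ↦ p) = P.p := by ext i j; simp [hPp]
    rw [Matrix.conjTranspose_mul, P.sa, Matrix.mul_assoc, ← Matrix.mul_assoc (Matrix.diagonal _),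
      Matrix.diagonal_conjTranspose, Matrix.diagonal_mul_diagonal, ← Matrix.mul_assoc]
    simp only [Pi.star_apply, hx, this, P.idem]
  · rw [← Matrix.mul_assoc, P.idem]
  · rw [Matrix.mul_diagonal, mul_assoc, hxr]

lemma IsStarProjection.eq_mul_of_mul_star_eq {A : Type*} [NonUnitalCStarAlgebra A] {p x : A}
    (hp : IsStarProjection p) (hx : x * star x = p) : p * x = x := by
  rw [← sub_eq_zero, ← CStarRing.mul_star_self_eq_zero_iff]
  have h1 : p * x * star x = p := by rw [mul_assoc, hx, hp.isIdempotentElem.eq]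
  rw [star_sub, star_mul, hp.isSelfAdjoint.star_eq, sub_mul, mul_sub, mul_sub, ← mul_assoc, h1,
    ← mul_assoc, hx, hp.isIdempotentElem.eq]
  simp

open CStarAlgebra Filter Topology in
/-- Over a C⋆-algebra of real rank zero every matrix projection is equivalent to one with entries
in the corner of some projection. -/
lemma RealRankZero.exists_mvNEquiv_inCorner {B : Type*} [NonUnitalCStarAlgebra B]
    (hB : RealRankZero B) (P : MatProj B) :
    ∃ p : B, p * p = p ∧ star p = p ∧
      ∃ Q : MatProj B, (∀ i j, InCorner p (Q.p i j)) ∧ MvNEquiv P Q := by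
  let _ := spectralOrder B
  have _ := spectralOrderedRing B
  choose r hr hPr using fun k : ℕ ↦ hB.exists_isStarProjection
    (fun ij : Fin P.n × Fin P.n ↦ P.p ij.1 ij.2) (Nat.one_div_pos_of_nat (α := ℝ) (n := k))
  let T : CStarMatrix (Fin P.n) (Fin P.n) B := CStarMatrix.ofMatrix P.p
  let D (k : ℕ) : CStarMatrix (Fin P.n) (Fin P.n) B :=
    CStarMatrix.ofMatrix (Matrix.diagonal fun _ ↦ r k)
  have hT : IsStarProjection T := ⟨P.idem, P.sa⟩
  have hD (k) : IsStarProjection (D k) := by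
    constructor
    · refine (Matrix.diagonal_mul_diagonal _ _).trans (congrArg _ ?_)
      exact funext fun _ ↦ (hr k).isIdempotentElem
    · change (Matrix.diagonal _).conjTranspose = Matrix.diagonal _
      rw [Matrix.diagonal_conjTranspose]
      congr 1
      ext
      exact (hr k).isSelfAdjoint
  have hlim : Tendsto (fun k ↦ T - T * D k) atTop (𝓝 0) := by
    refine tendsto_pi_nhds.2 fun i ↦ tendsto_pi_nhds.2 fun j ↦ ?_
    refine squeeze_zero_norm (fun k ↦ ?_) tendsto_one_div_add_atTop_nhds_zero_nat
    have : (T - T * D k) i j = P.p i j - P.p i j * r k :=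
      congrArg (P.p i j - ·) (Matrix.mul_diagonal _ _ _ _)
    exact this ▸ (hPr k (i, j)).le
  obtain ⟨k, hk⟩ := ((tendsto_zero_iff_norm_tendsto_zero.1 hlim).eventually_lt_const
    one_pos).exists
  obtain ⟨x, hx, hxD⟩ := exists_mul_star_eq_of_norm_sub_mul_lt_one hT (hD k) hk
  refine ⟨r k, (hr k).isIdempotentElem, (hr k).isSelfAdjoint,
    P.exists_mvNEquiv_inCorner (hr k).isSelfAdjoint (CStarMatrix.ofMatrix.symm x) hx
      (hT.eq_mul_of_mul_star_eq hx) fun i j ↦ ?_⟩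
  have := congrFun (congrFun hxD i) j
  rwa [show (x * D k) i j = CStarMatrix.ofMatrix.symm x i j * r k from
    Matrix.mul_diagonal _ _ _ _] at this

/-- for a nonunital C*-algebra `B` with real rank zero, `V(B)` is the
direct limit of the `V(pBp)` over projections `p ∈ B`: (directedness) for any two
projections `p, q ∈ B` there is a projection `r ∈ B` such that every projection in
matrices over `pBp` or over `qBq` is Murray–von Neumann equivalent to one with entries
in `rBr`; and every projection in matrices over `B` is equivalent to one with entries
in some corner `pBp`. -/
theorem V_direct_limit_of_corners
    {B : Type*} [NonUnitalCStarAlgebra B]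
    (hnu : ¬ ∃ e : B, ∀ x : B, e * x = x ∧ x * e = x)
    (hrr0 : RealRankZero B) :
    (∀ p q : B, p * p = p → star p = p → q * q = q → star q = q →
      ∃ r : B, r * r = r ∧ star r = r ∧
        (∀ P : MatProj B, (∀ i j, InCorner p (P.p i j)) →
          ∃ Q : MatProj B, (∀ i j, InCorner r (Q.p i j)) ∧ MvNEquiv P Q) ∧
        (∀ P : MatProj B, (∀ i j, InCorner q (P.p i j)) →
          ∃ Q : MatProj B, (∀ i j, InCorner r (Q.p i j)) ∧ MvNEquiv P Q)) ∧
    (∀ P : MatProj B, ∃ p : B, p * p = p ∧ star p = p ∧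
      ∃ Q : MatProj B, (∀ i j, InCorner p (Q.p i j)) ∧ MvNEquiv P Q) := by
  refine ⟨fun p q hp hps hq hqs ↦ ?_, hrr0.exists_mvNEquiv_inCorner⟩
  obtain ⟨r, hr, hpqr⟩ := hrr0.exists_isStarProjection ![p, q] one_pos
  obtain ⟨x, hx, hxr⟩ := exists_mul_star_eq_of_norm_sub_mul_lt_one ⟨hp, hps⟩ hr (hpqr 0)
  obtain ⟨y, hy, hyr⟩ := exists_mul_star_eq_of_norm_sub_mul_lt_one ⟨hq, hqs⟩ hr (hpqr 1)
  exact ⟨r, hr.isIdempotentElem, hr.isSelfAdjoint,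
    fun P ↦ P.exists_mvNEquiv_of_inCorner hp hr.isSelfAdjoint hx hxr,
    fun P ↦ P.exists_mvNEquiv_of_inCorner hq hr.isSelfAdjoint hy hyr⟩
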